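/- Let A be a set of graphs and C a bridge-stable class of connected graphs, each of which is bridge-addable in A. Then for R_n uniform on A_n, the random variable κ⁺(R_n,C) is stochastically dominated by 1 + Po(1), where Po(1) is a Poisson random variable with mean 1. -/

import Mathlib

open scoped Classical

/-- Membership of a graph `H` in an isomorphism-closed class `C`. -/
def memClass (C : ∀ m : ℕ, Set (SimpleGraph (Fin m))) {V : Type*} (H : SimpleGraph V) : Prop :=
  ∃ H' ∈ C (Nat.card V), Nonempty (H ≃g H')

/-- Add the edge `uv` to `G`. -/
def addEdge {V : Type*} (G : SimpleGraph V) (u v : V) : SimpleGraph V :=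
  G ⊔ SimpleGraph.fromEdgeSet {s(u, v)}

/-- The component of `v` in `G`, as a graph. -/
abbrev compGraph {n : ℕ} (G : SimpleGraph (Fin n)) (v : Fin n) :=
  G.induce (G.connectedComponentMk v).supp

/-- The component `c`, as a graph. -/
abbrev compGraph' {n : ℕ} (G : SimpleGraph (Fin n)) (c : G.ConnectedComponent) :=
  G.induce c.supp

/-- `C` is bridge-stable: adding a bridge between two disjoint graphs both in `C` yields a
graph of `C`, while adding a bridge between two disjoint graphs exactly one of which lies in
`C` yields a graph not in `C`. (The two disjoint graphs are realised as the two sides `S`,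
`Sᶜ` of a graph with no edges between them.) -/
def bridgeStable (C : ∀ m : ℕ, Set (SimpleGraph (Fin m))) : Prop :=
  ∀ (m : ℕ) (G : SimpleGraph (Fin m)) (S : Set (Fin m)) (u v : Fin m),
    u ∈ S → v ∉ S → (∀ x ∈ S, ∀ y, y ∉ S → ¬ G.Adj x y) →
    ((memClass C (G.induce S) ∧ memClass C (G.induce Sᶜ)) → memClass C (addEdge G u v)) ∧
    ((memClass C (G.induce S) ↔ ¬ memClass C (G.induce Sᶜ)) → ¬ memClass C (addEdge G u v))

/-- `κ⁺(G, C)`: the number of components of `G` in `C`, plus `1` if some component of `G`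
is not in `C`. -/
noncomputable def kappaPlus (C : ∀ m : ℕ, Set (SimpleGraph (Fin m))) {n : ℕ}
    (G : SimpleGraph (Fin n)) : ℕ :=
  Nat.card {c : G.ConnectedComponent // memClass C (compGraph' G c)} +
    (if ∀ c : G.ConnectedComponent, memClass C (compGraph' G c) then 0 else 1)

namespace Aux6

lemma merge_card {V α β : Type*} [Fintype V] [DecidableEq α] [DecidableEq β] (f : V → α) (g : V → β) (u v : V) (huv : f u ≠ f v)
    (h : ∀ x y, g x = g y ↔ (f x = f y ∨ (f x = f u ∧ f y = f v) ∨ (f x = f v ∧ f y = f u))) :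
    (Finset.univ.image f).card = (Finset.univ.image g).card + 1 := by
  have key : (Finset.univ.image g).card = ((Finset.univ.image f).erase (f u)).card := by
    symm
    have hex : ∀ a ∈ (Finset.univ.image f).erase (f u), ∃ x, f x = a := by
      intro a ha
      simpa using (Finset.mem_erase.1 ha).2
    have : Nonempty V := ⟨u⟩
    choose! r hr using hex
    refine Finset.card_bij (fun a _ => g (r a)) ?_ ?_ ?_
    · intro a ha; simp
    · intro a ha b hb hab
      have h1 := hr a ha
      have h2 := hr b hb
      rw [Finset.mem_erase] at ha hb
      simp only [h, h1, h2] at hab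
      grind
    · intro b hb
      obtain ⟨x, -, rfl⟩ := Finset.mem_image.1 hb
      by_cases hx : f x = f u
      · have hm : f v ∈ (Finset.univ.image f).erase (f u) := by simp [huv.symm]
        refine ⟨f v, hm, ?_⟩
        rw [h, hr _ hm]; grind
      · have hm : f x ∈ (Finset.univ.image f).erase (f u) := by simp [hx]
        refine ⟨f x, hm, ?_⟩
        rw [h, hr _ hm]; grind
  rw [key, Finset.card_erase_add_one]
  simp

lemma addEdge_adj {V : Type*} (G : SimpleGraph V) (u v x y : V) :
    (addEdge G u v).Adj x y ↔ G.Adj x y ∨ (((x = u ∧ y = v) ∨ (x = v ∧ y = u)) ∧ x ≠ y) := by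
  simp [addEdge, SimpleGraph.fromEdgeSet_adj]

lemma reach_addEdge {V : Type*} (G : SimpleGraph V) (u v : V) (huv : u ≠ v) (x y : V) :
    (addEdge G u v).Reachable x y ↔ (G.Reachable x y ∨ (G.Reachable x u ∧ G.Reachable v y) ∨
      (G.Reachable x v ∧ G.Reachable u y)) := by
  have hle : G ≤ addEdge G u v := le_sup_left
  have hadj : (addEdge G u v).Adj u v := by rw [addEdge_adj]; grind
  constructor
  · rintro ⟨w⟩
    induction w with
    | nil => left; rfl
    | @cons a b c hab w ih =>
      rw [addEdge_adj] at hab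
      rcases hab with hab | ⟨⟨rfl, rfl⟩ | ⟨rfl, rfl⟩, hne⟩
      · have := hab.reachable
        rcases ih with h | ⟨h1, h2⟩ | ⟨h1, h2⟩
        · exact Or.inl (this.trans h)
        · exact Or.inr (Or.inl ⟨this.trans h1, h2⟩)
        · exact Or.inr (Or.inr ⟨this.trans h1, h2⟩)
      · rcases ih with h | ⟨h1, h2⟩ | ⟨h1, h2⟩
        · exact Or.inr (Or.inl ⟨.refl _, h⟩)
        · exact Or.inr (Or.inl ⟨.refl _, h2⟩)
        · exact Or.inl h2
      · rcases ih with h | ⟨h1, h2⟩ | ⟨h1, h2⟩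
        · exact Or.inr (Or.inr ⟨.refl _, h⟩)
        · exact Or.inl h2
        · exact Or.inr (Or.inr ⟨.refl _, h2⟩)
  · rintro (h | ⟨h1, h2⟩ | ⟨h1, h2⟩)
    · exact h.mono hle
    · exact ((h1.mono hle).trans hadj.reachable).trans (h2.mono hle)
    · exact ((h1.mono hle).trans hadj.symm.reachable).trans (h2.mono hle)

/-- Number of components. -/
noncomputable def ncc {V : Type*} [Fintype V] (G : SimpleGraph V) : ℕ :=
  (Finset.univ.image G.connectedComponentMk).card

lemma ncc_addEdge {V : Type*} [Fintype V] (G : SimpleGraph V) (u v : V)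
    (h : ¬ G.Reachable u v) : ncc G = ncc (addEdge G u v) + 1 := by
  have huv : u ≠ v := by rintro rfl; exact h (.refl _)
  refine merge_card _ _ u v ?_ ?_
  · simpa [SimpleGraph.ConnectedComponent.eq] using h
  · intro x y
    simp only [SimpleGraph.ConnectedComponent.eq, reach_addEdge G u v huv]
    have := @SimpleGraph.Reachable.symm V G
    grind

/-- Ordered bridge pairs. -/
noncomputable def brs {V : Type*} [Fintype V] (G : SimpleGraph V) : Finset (V × V) :=
  Finset.univ.filter (fun p => G.Adj p.1 p.2 ∧ ¬ (G.deleteEdges {s(p.1, p.2)}).Reachable p.1 p.2)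

lemma brs_bound {V : Type*} [Fintype V] : ∀ (k : ℕ) (G : SimpleGraph V), (brs G).card ≤ k →
    (brs G).card + 2 * ncc G ≤ 2 * Fintype.card V := by
  intro k
  induction k using Nat.strong_induction_on with
  | _ k ih =>
  intro G hk
  by_cases he : brs G = ∅
  · rw [he]
    have : ncc G ≤ Fintype.card V := Finset.card_image_le
    simpa using this
  · obtain ⟨⟨u, v⟩, hp⟩ := Finset.nonempty_iff_ne_empty.2 he
    have hp' := hp
    simp only [brs, Finset.mem_filter, Finset.mem_univ, true_and] at hp'
    obtain ⟨hadj, hnr⟩ := hp'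
    set G0 := G.deleteEdges {s(u, v)} with hG0
    have hG : G = addEdge G0 u v := by
      ext x y
      rw [addEdge_adj, hG0, SimpleGraph.deleteEdges_adj]
      have := hadj.symm
      have := G.ne_of_adj (a := x) (b := y)
      simp only [Set.mem_singleton_iff, Sym2.eq_iff]
      grind
    have hn := ncc_addEdge G0 u v hnr
    rw [← hG] at hn
    have hnot : (u, v) ∉ brs G0 := by
      simp [brs, hG0, SimpleGraph.deleteEdges_adj]
    have hsub : brs G ⊆ insert (u, v) (insert (v, u) (brs G0)) := by
      rintro ⟨x, y⟩ hxy
      simp only [brs, Finset.mem_filter, Finset.mem_univ, true_and, Finset.mem_insert] at hxy ⊢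
      by_cases h1 : s(x, y) = s(u, v)
      · rw [Sym2.eq_iff] at h1; grind
      · right; right
        refine ⟨?_, fun h => hxy.2 (h.mono ?_)⟩
        · rw [hG0, SimpleGraph.deleteEdges_adj]; exact ⟨hxy.1, h1⟩
        · exact SimpleGraph.deleteEdges_mono (SimpleGraph.deleteEdges_le _)
    have hcard := (Finset.card_le_card hsub).trans (Finset.card_insert_le _ _)
    have hcard2 := Finset.card_insert_le (v, u) (brs G0)
    have hsub2 : brs G0 ⊆ (brs G).erase (u, v) := by
      rintro ⟨x, y⟩ hxy
      rw [Finset.mem_erase]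
      refine ⟨fun h => hnot (h ▸ hxy), ?_⟩
      simp only [brs, Finset.mem_filter, Finset.mem_univ, true_and] at hxy ⊢
      have hne : s(x, y) ≠ s(u, v) := by
        have := hxy.1
        rw [hG0, SimpleGraph.deleteEdges_adj] at this
        exact this.2
      refine ⟨(SimpleGraph.deleteEdges_le _) hxy.1, ?_⟩
      have hb : ¬ (G0.deleteEdges {s(x, y)}).Reachable x y := hxy.2
      have e1 : G.deleteEdges {s(x, y)} = addEdge (G0.deleteEdges {s(x, y)}) u v := by
        ext a b
        rw [addEdge_adj, hG0]
        simp only [SimpleGraph.deleteEdges_adj]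
        have := hadj.symm
        have := G.ne_of_adj (a := a) (b := b)
        simp only [Set.mem_singleton_iff, Sym2.eq_iff] at hne ⊢
        grind
      rw [e1, reach_addEdge _ _ _ hadj.ne]
      have hd : G0.deleteEdges {s(x, y)} ≤ G0 := SimpleGraph.deleteEdges_le _
      have hxyr : G0.Reachable x y := hxy.1.reachable
      rintro (h | ⟨h1, h2⟩ | ⟨h1, h2⟩)
      · exact hb h
      · exact hnr (((h1.mono hd).symm.trans hxyr).trans (h2.mono hd).symm)
      · exact hnr (((h2.mono hd).trans hxyr.symm).trans (h1.mono hd))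
    have hlt := Finset.card_le_card hsub2
    rw [Finset.card_erase_of_mem hp] at hlt
    have hpos : 0 < (brs G).card := Finset.card_pos.2 ⟨_, hp⟩
    have := ih (brs G0).card (by omega) G0 le_rfl
    omega

lemma cross_bound {V α : Type*} [Fintype V] [DecidableEq α] (p : V → α) (m : ℕ)
    (hm : (Finset.univ.image p).card = m) (hm2 : 2 ≤ m) :
    (m - 1) * (2 * (Fintype.card V - m + 1)) ≤
      (Finset.univ.filter (fun q : V × V => p q.1 ≠ p q.2)).card := by
  set n := Fintype.card V with hn
  set I := Finset.univ.image p with hI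
  let s : α → ℕ := fun a => (Finset.univ.filter (fun x => p x = a)).card
  have hmaps : ∀ x ∈ (Finset.univ : Finset V), p x ∈ I := fun x _ => by simp [hI]
  have hsum : ∑ a ∈ I, s a = n := (Finset.card_eq_sum_card_fiberwise hmaps).symm
  have hs1 : ∀ a ∈ I, 1 ≤ s a := by
    intro a ha
    obtain ⟨x, -, rfl⟩ := Finset.mem_image.1 ha
    exact Finset.card_pos.2 ⟨x, by simp⟩
  have hs2 : ∀ a ∈ I, s a + (m - 1) ≤ n := by
    intro a ha
    rw [← hsum, ← Finset.add_sum_erase _ _ ha]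
    have : (I.erase a).card • 1 ≤ ∑ b ∈ I.erase a, s b :=
      Finset.card_nsmul_le_sum _ _ _ (fun b hb => hs1 b (Finset.mem_of_mem_erase hb))
    rw [Finset.card_erase_of_mem ha, hm] at this
    simp at this
    omega
  have hcount : (Finset.univ.filter (fun q : V × V => p q.1 ≠ p q.2)).card
      = ∑ a ∈ I, s a * (n - s a) := by
    rw [Finset.card_eq_sum_card_fiberwise (f := fun q : V × V => p q.1) (t := I)
      (fun q _ => by simp [hI])]
    refine Finset.sum_congr rfl fun a ha => ?_
    have : Finset.filter (fun q : V × V => p q.1 = a)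
        (Finset.univ.filter (fun q : V × V => p q.1 ≠ p q.2))
        = (Finset.univ.filter (fun x => p x = a)) ×ˢ (Finset.univ.filter (fun x => p x = a))ᶜ := by
      ext ⟨x, y⟩
      simp
      grind
    rw [this, Finset.card_product, Finset.card_compl]
  have hmn : m ≤ n := by rw [← hm]; exact Finset.card_image_le
  rw [hcount]
  have hz : ∑ a ∈ I, ((s a : ℤ) * (m - 2) + (n - m + 1)) ≤ ∑ a ∈ I, (s a : ℤ) * (n - s a) := by
    refine Finset.sum_le_sum fun a ha => ?_
    have h1 : (1 : ℤ) ≤ s a := by exact_mod_cast hs1 a ha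
    have h2 : (s a : ℤ) + (m - 1) ≤ n := by have := hs2 a ha; omega
    nlinarith
  rw [Finset.sum_add_distrib, ← Finset.sum_mul, ← Nat.cast_sum, hsum, Finset.sum_const, hm] at hz
  have hz2 : ((∑ a ∈ I, s a * (n - s a) : ℕ) : ℤ) = ∑ a ∈ I, (s a : ℤ) * (n - s a) := by
    rw [Nat.cast_sum]
    refine Finset.sum_congr rfl fun a ha => ?_
    have := hs2 a ha
    rw [Nat.cast_mul, Nat.cast_sub (by omega)]
  zify [hmn, (by omega : 1 ≤ m)]
  push_cast at hz2
  have hz3 : ((∑ a ∈ I, s a * (n - s a) : ℕ) : ℤ) = ∑ a ∈ I, (s a : ℤ) * ((n - s a : ℕ) : ℤ) := by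
    push_cast; rfl
  simp only [nsmul_eq_mul] at hz
  have h2 : (2 : ℤ) ≤ m := by exact_mod_cast hm2
  rw [hz2]
  refine le_trans ?_ hz
  nlinarith


lemma memClass_iso (C : ∀ m : ℕ, Set (SimpleGraph (Fin m))) {V W : Type*} {G : SimpleGraph V}
    {H : SimpleGraph W} (e : G ≃g H) : memClass C G ↔ memClass C H := by
  have hc : Nat.card V = Nat.card W := Nat.card_congr e.toEquiv
  unfold memClass
  rw [hc]
  constructor
  · rintro ⟨H', h, ⟨f⟩⟩
    exact ⟨H', h, ⟨e.symm.trans f⟩⟩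
  · rintro ⟨H', h, ⟨f⟩⟩
    exact ⟨H', h, ⟨e.trans f⟩⟩

/-- Pulling back an induced subgraph along an injection. -/
noncomputable def pullIso {V W : Type*} (G : SimpleGraph V) (φ : W → V)
    (hφ : Function.Injective φ) (T : Set V) (S : Set W) (hS : ∀ w, w ∈ S ↔ φ w ∈ T)
    (hT : ∀ x ∈ T, ∃ w, φ w = x) :
    (G.comap φ).induce S ≃g G.induce T where
  toEquiv := Equiv.ofBijective (fun w => ⟨φ w.1, (hS _).1 w.2⟩) (by
    constructor
    · rintro ⟨a, ha⟩ ⟨b, hb⟩ h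
      simp only [Subtype.mk.injEq] at h ⊢
      exact hφ h
    · rintro ⟨x, hx⟩
      obtain ⟨w, rfl⟩ := hT x hx
      exact ⟨⟨w, (hS w).2 hx⟩, rfl⟩)
  map_rel_iff' := by
    rintro ⟨a, ha⟩ ⟨b, hb⟩
    exact Iff.rfl

lemma stable_sets {C : ∀ m : ℕ, Set (SimpleGraph (Fin m))} (hst : bridgeStable C)
    {n : ℕ} (G : SimpleGraph (Fin n)) (T₁ T₂ : Set (Fin n)) (hd : ∀ x ∈ T₁, x ∉ T₂)
    (u v : Fin n) (hu : u ∈ T₁) (hv : v ∈ T₂) (hno : ∀ x ∈ T₁, ∀ y ∈ T₂, ¬ G.Adj x y)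
    (hor : memClass C (G.induce T₁) ∨ memClass C (G.induce T₂)) :
    memClass C ((addEdge G u v).induce (T₁ ∪ T₂)) ↔
      (memClass C (G.induce T₁) ∧ memClass C (G.induce T₂)) := by
  let e : Fin (Fintype.card ↥(T₁ ∪ T₂)) ≃ ↥(T₁ ∪ T₂) := (Fintype.equivFin _).symm
  let φ : Fin (Fintype.card ↥(T₁ ∪ T₂)) → Fin n := fun i => (e i).1
  have hφ : Function.Injective φ := Subtype.val_injective.comp e.injective
  have hmem : ∀ i, φ i ∈ T₁ ∪ T₂ := fun i => (e i).2
  have hsurj : ∀ x ∈ T₁ ∪ T₂, ∃ w, φ w = x := fun x hx => ⟨e.symm ⟨x, hx⟩, by simp [φ]⟩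
  obtain ⟨a, rfl⟩ := hsurj u (Or.inl hu)
  obtain ⟨b, rfl⟩ := hsurj v (Or.inr hv)
  have h := hst _ (G.comap φ) (φ ⁻¹' T₁) a b hu (fun hb => hd _ hb hv) (by
    intro x hx y hy
    refine hno _ hx _ ?_
    exact (hmem y).resolve_left hy)
  have i1 := memClass_iso C (pullIso G φ hφ T₁ (φ ⁻¹' T₁) (fun _ => Iff.rfl)
    (fun x hx => hsurj x (Or.inl hx)))
  have i2 := memClass_iso C (pullIso G φ hφ T₂ (φ ⁻¹' T₁)ᶜ (fun w => by
      constructor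
      · intro hw; exact (hmem w).resolve_left hw
      · intro hw h1; exact hd _ h1 hw)
    (fun x hx => hsurj x (Or.inr hx)))
  have i3 : addEdge (G.comap φ) a b ≃g (addEdge G (φ a) (φ b)).induce (T₁ ∪ T₂) :=
    { toEquiv := e
      map_rel_iff' := by
        intro x y
        have h1 : ∀ x y, φ x = φ y ↔ x = y := fun x y => hφ.eq_iff
        have : ((addEdge G (φ a) (φ b)).induce (T₁ ∪ T₂)).Adj (e x) (e y) ↔
          (addEdge G (φ a) (φ b)).Adj (φ x) (φ y) := Iff.rfl
        rw [this, addEdge_adj, addEdge_adj]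
        simp only [ne_eq, h1, SimpleGraph.comap_adj] }
  rw [← memClass_iso C i3, ← i1, ← i2]
  rw [← i1, ← i2] at hor
  tauto

/-- The vertex lies in a component of the class. -/
def good (C : ∀ m : ℕ, Set (SimpleGraph (Fin m))) {n : ℕ} (G : SimpleGraph (Fin n))
    (x : Fin n) : Prop := memClass C (compGraph G x)

/-- The part of a vertex. -/
noncomputable def part (C : ∀ m : ℕ, Set (SimpleGraph (Fin m))) {n : ℕ} (G : SimpleGraph (Fin n))
    (x : Fin n) : Option G.ConnectedComponent :=
  if good C G x then some (G.connectedComponentMk x) else none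

lemma good_congr (C : ∀ m : ℕ, Set (SimpleGraph (Fin m))) {n : ℕ} (G : SimpleGraph (Fin n))
    {x y : Fin n} (h : G.Reachable x y) : good C G x ↔ good C G y := by
  unfold good compGraph
  rw [SimpleGraph.ConnectedComponent.eq.2 h]

lemma part_eq (C : ∀ m : ℕ, Set (SimpleGraph (Fin m))) {n : ℕ} (G : SimpleGraph (Fin n))
    (x y : Fin n) : part C G x = part C G y ↔
      ((good C G x ∧ good C G y ∧ G.Reachable x y) ∨ (¬ good C G x ∧ ¬ good C G y)) := by
  unfold part
  by_cases hx : good C G x <;> by_cases hy : good C G y <;>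
    simp [hx, hy]

lemma kappa_eq (C : ∀ m : ℕ, Set (SimpleGraph (Fin m))) {n : ℕ} (G : SimpleGraph (Fin n)) :
    kappaPlus C G = (Finset.univ.image (part C G)).card := by
  have hmk : ∀ c : G.ConnectedComponent, ∃ x, G.connectedComponentMk x = c := fun c => c.exists_rep
  have hne : Disjoint ((Finset.univ.filter
      (fun c : G.ConnectedComponent => memClass C (compGraph' G c))).image some)
      (if ∀ c : G.ConnectedComponent, memClass C (compGraph' G c) then ∅ else {none}) := by
    rw [Finset.disjoint_left]
    intro a ha hb
    obtain ⟨c, -, rfl⟩ := Finset.mem_image.1 ha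
    split_ifs at hb <;> simp at hb
  have : Finset.univ.image (part C G) = ((Finset.univ.filter
      (fun c : G.ConnectedComponent => memClass C (compGraph' G c))).image some) ∪
      (if ∀ c : G.ConnectedComponent, memClass C (compGraph' G c) then ∅ else {none}) := by
    ext a
    rw [Finset.mem_union]
    cases a with
    | none =>
      have h1 : none ∈ Finset.univ.image (part C G) ↔ ∃ x, ¬ good C G x := by
        simp [part]
      rw [h1]
      split_ifs with h
      · simp; intro x; exact h _
      · simp
        push Not at h
        obtain ⟨c, hc⟩ := h
        obtain ⟨x, rfl⟩ := hmk c
        exact ⟨x, hc⟩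
    | some c =>
      obtain ⟨x, rfl⟩ := hmk c
      have h2 : some (G.connectedComponentMk x) ∉
        (if ∀ c : G.ConnectedComponent, memClass C (compGraph' G c) then ∅ else {none} :
          Finset (Option G.ConnectedComponent)) := by split_ifs <;> simp
      simp only [h2, or_false, Finset.mem_image, Finset.mem_univ, true_and, Finset.mem_filter,
        Option.some.injEq, exists_eq_right]
      constructor
      · rintro ⟨y, hy⟩
        unfold part at hy
        split_ifs at hy with hg
        rw [Option.some.injEq] at hy
        rw [← hy]; exact hg
      · intro h
        exact ⟨x, if_pos h⟩
  rw [this, Finset.card_union_of_disjoint hne, Finset.card_image_of_injective _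
    (Option.some_injective _)]
  unfold kappaPlus
  rw [Nat.card_eq_fintype_card, Fintype.card_subtype]
  congr 1
  split_ifs <;> simp

lemma kappa_le_ncc (C : ∀ m : ℕ, Set (SimpleGraph (Fin m))) {n : ℕ} (G : SimpleGraph (Fin n)) :
    kappaPlus C G ≤ ncc G := by
  rw [kappa_eq]
  have : part C G = (fun c => if memClass C (compGraph' G c) then some c else none) ∘
      G.connectedComponentMk := by
    ext x : 1
    rfl
  rw [this, ← Finset.image_image]
  exact Finset.card_image_le

lemma good_addEdge {C : ∀ m : ℕ, Set (SimpleGraph (Fin m))} (hst : bridgeStable C)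
    {n : ℕ} (G : SimpleGraph (Fin n)) (u v : Fin n) (h : ¬ G.Reachable u v)
    (hor : good C G u ∨ good C G v) (x : Fin n) :
    good C (addEdge G u v) x ↔ (if G.Reachable x u ∨ G.Reachable x v then
      good C G u ∧ good C G v else good C G x) := by
  have huv : u ≠ v := by rintro rfl; exact h (.refl _)
  have hsupp : ∀ (H : SimpleGraph (Fin n)) (x y : Fin n),
      y ∈ (H.connectedComponentMk x).supp ↔ H.Reachable x y := by
    intro H x y
    rw [SimpleGraph.ConnectedComponent.mem_supp_iff, SimpleGraph.ConnectedComponent.eq]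
    exact ⟨fun h => h.symm, fun h => h.symm⟩
  split_ifs with hx
  · have e : ((addEdge G u v).connectedComponentMk x).supp =
      (G.connectedComponentMk u).supp ∪ (G.connectedComponentMk v).supp := by
      ext y
      rw [Set.mem_union, hsupp, hsupp, hsupp, reach_addEdge G u v huv]
      constructor
      · rintro (h1 | h1 | h1)
        · rcases hx with h2 | h2
          · exact Or.inl (h2.symm.trans h1)
          · exact Or.inr (h2.symm.trans h1)
        · exact Or.inr h1.2
        · exact Or.inl h1.2
      · rcases hx with h2 | h2
        · rintro (h1 | h1)
          · exact Or.inl (h2.trans h1)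
          · exact Or.inr (Or.inl ⟨h2, h1⟩)
        · rintro (h1 | h1)
          · exact Or.inr (Or.inr ⟨h2, h1⟩)
          · exact Or.inl (h2.trans h1)
    have := stable_sets hst G (G.connectedComponentMk u).supp (G.connectedComponentMk v).supp
      (fun x h1 h2 => h (((hsupp _ _ _).1 h1).trans ((hsupp _ _ _).1 h2).symm)) u v
      ((hsupp _ _ _).2 (.refl _)) ((hsupp _ _ _).2 (.refl _))
      (fun x h1 y h2 h3 => h ((((hsupp _ _ _).1 h1).trans h3.reachable).trans
        ((hsupp _ _ _).1 h2).symm)) hor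
    unfold good compGraph
    rw [e]
    exact this
  · push Not at hx
    have e : ((addEdge G u v).connectedComponentMk x).supp = (G.connectedComponentMk x).supp := by
      ext y
      rw [hsupp, hsupp, reach_addEdge G u v huv]
      tauto
    have e2 : (addEdge G u v).induce (G.connectedComponentMk x).supp =
        G.induce (G.connectedComponentMk x).supp := by
      ext ⟨a, ha⟩ ⟨b, hb⟩
      rw [hsupp] at ha hb
      simp only [SimpleGraph.comap_adj, Function.Embedding.subtype_apply, addEdge_adj]
      constructor
      · rintro (h1 | ⟨⟨rfl, rfl⟩ | ⟨rfl, rfl⟩, _⟩)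
        · exact h1
        · exact absurd ha hx.1
        · exact absurd ha hx.2
      · exact Or.inl
    unfold good compGraph
    rw [e, e2]

lemma kappa_addEdge {C : ∀ m : ℕ, Set (SimpleGraph (Fin m))} (hst : bridgeStable C)
    {n : ℕ} (G : SimpleGraph (Fin n)) (u v : Fin n) (h : part C G u ≠ part C G v) :
    kappaPlus C G = kappaPlus C (addEdge G u v) + 1 := by
  rw [kappa_eq, kappa_eq]
  refine merge_card _ _ u v h ?_
  intro x y
  rw [Ne, part_eq] at h
  have hnr : ¬ G.Reachable u v := by
    intro hr
    have := good_congr C G hr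
    tauto
  have hor : good C G u ∨ good C G v := by tauto
  have huv : u ≠ v := by rintro rfl; exact hnr (.refl _)
  simp only [part_eq, good_addEdge hst G u v hnr hor, reach_addEdge G u v huv]
  have hsy := @SimpleGraph.Reachable.symm _ G
  have htr := @SimpleGraph.Reachable.trans _ G
  have hgc := @good_congr C n G
  have t1 := @hsy x y
  have t2 := @hsy y x
  by_cases xu : G.Reachable x u
  · have xv : ¬ G.Reachable x v := fun h => hnr (htr (hsy xu) h)
    have gx := hgc xu
    by_cases yu : G.Reachable y u
    · have yv : ¬ G.Reachable y v := fun h => hnr (htr (hsy yu) h)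
      have gy := hgc yu
      have xy := htr xu (hsy yu)
      simp [xu, xv, yu, yv, gx, gy, xy, hsy yu] <;> (clear hsy htr hgc t1 t2 hst; grind)
    · by_cases yv : G.Reachable y v
      · have gy := hgc yv
        have xy : ¬ G.Reachable x y := fun h => yu (htr (hsy h) xu)
        simp [xu, xv, yu, yv, gx, gy, xy, hsy yv] <;> (clear hsy htr hgc t1 t2 hst; grind)
      · have xy : ¬ G.Reachable x y := fun h => yu (htr (hsy h) xu)
        have uy : ¬ G.Reachable u y := fun h => yu (hsy h)
        have vy : ¬ G.Reachable v y := fun h => yv (hsy h)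
        simp [xu, xv, yu, yv, gx, xy, uy, vy] <;> (clear hsy htr hgc t1 t2 hst; grind)
  · by_cases xv : G.Reachable x v
    · have gx := hgc xv
      by_cases yu : G.Reachable y u
      · have yv : ¬ G.Reachable y v := fun h => hnr (htr (hsy yu) h)
        have gy := hgc yu
        have xy : ¬ G.Reachable x y := fun h => xu (htr h yu)
        simp [xu, xv, yu, yv, gx, gy, xy, hsy yu] <;> (clear hsy htr hgc t1 t2 hst; grind)
      · by_cases yv : G.Reachable y v
        · have gy := hgc yv
          have xy : G.Reachable x y := htr xv (hsy yv)
          simp [xu, xv, yu, yv, gx, gy, xy, hsy yv] <;> (clear hsy htr hgc t1 t2 hst; grind)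
        · have xy : ¬ G.Reachable x y := fun h => yv (htr (hsy h) xv)
          have uy : ¬ G.Reachable u y := fun h => yu (hsy h)
          have vy : ¬ G.Reachable v y := fun h => yv (hsy h)
          simp [xu, xv, yu, yv, gx, xy, uy, vy] <;> (clear hsy htr hgc t1 t2 hst; grind)
    · have ux : ¬ G.Reachable u x := fun h => xu (hsy h)
      by_cases yu : G.Reachable y u
      · have yv : ¬ G.Reachable y v := fun h => hnr (htr (hsy yu) h)
        have gy := hgc yu
        have xy : ¬ G.Reachable x y := fun h => xu (htr h yu)
        simp [xu, xv, yu, yv, gy, xy] <;> (clear hsy htr hgc t1 t2 hst; grind)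
      · by_cases yv : G.Reachable y v
        · have gy := hgc yv
          have xy : ¬ G.Reachable x y := fun h => xv (htr h yv)
          simp [xu, xv, yu, yv, gy, xy] <;> (clear hsy htr hgc t1 t2 hst; grind)
        · simp [xu, xv, yu, yv] <;> (clear hsy htr hgc t1 t2 hst; grind)

lemma step {n : ℕ} (𝒜 : Finset (SimpleGraph (Fin n)))
    (C : ∀ m : ℕ, Set (SimpleGraph (Fin m)))
    (hstable : bridgeStable C)
    (hAdd : ∀ G ∈ 𝒜, ∀ u v : Fin n,
      G.connectedComponentMk u ≠ G.connectedComponentMk v →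
      memClass C (compGraph G u) → addEdge G u v ∈ 𝒜) (k : ℕ) :
    (k + 1) * (𝒜.filter (fun G => kappaPlus C G = k + 2)).card ≤
      (𝒜.filter (fun G => kappaPlus C G = k + 1)).card := by
  set A2 := 𝒜.filter (fun G => kappaPlus C G = k + 2) with hA2
  set A1 := 𝒜.filter (fun G => kappaPlus C G = k + 1) with hA1
  rcases A2.eq_empty_or_nonempty with h0 | ⟨G0, hG0⟩
  · simp [h0]
  have hkn : k + 2 ≤ n := by
    have h1 := (Finset.mem_filter.1 hG0).2
    rw [kappa_eq] at h1
    have := Finset.card_image_le (s := Finset.univ) (f := part C G0)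
    simp at this
    omega
  let X : Finset (Σ _ : SimpleGraph (Fin n), Fin n × Fin n) :=
    A2.sigma (fun G => Finset.univ.filter (fun q => part C G q.1 ≠ part C G q.2))
  let Y : Finset (Σ _ : SimpleGraph (Fin n), Fin n × Fin n) := A1.sigma (fun G => brs G)
  have hX : A2.card * ((k + 1) * (2 * (n - (k + 2) + 1))) ≤ X.card := by
    rw [Finset.card_sigma]
    rw [← smul_eq_mul]
    refine Finset.card_nsmul_le_sum _ _ _ fun G hG => ?_
    have h1 := (Finset.mem_filter.1 hG).2
    rw [kappa_eq] at h1
    have := cross_bound (part C G) (k + 2) h1 (by omega)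
    simpa using this
  have hY : Y.card ≤ A1.card * (2 * (n - (k + 2) + 1)) := by
    rw [Finset.card_sigma]
    rw [← smul_eq_mul]
    refine Finset.sum_le_card_nsmul _ _ _ fun G hG => ?_
    have h1 := (Finset.mem_filter.1 hG).2
    have h2 := kappa_le_ncc C G
    have h3 := brs_bound _ G le_rfl
    rw [Fintype.card_fin] at h3
    omega
  have nr : ∀ (G : SimpleGraph (Fin n)) (u v : Fin n), part C G u ≠ part C G v →
      ¬ G.Reachable u v := by
    intro G u v h hr
    rw [Ne, part_eq] at h
    have := good_congr C G hr
    tauto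
  have hdel : ∀ (G : SimpleGraph (Fin n)) (u v : Fin n), part C G u ≠ part C G v →
      (addEdge G u v).deleteEdges {s(u, v)} = G := by
    intro G u v h
    have hr := nr G u v h
    ext x y
    rw [SimpleGraph.deleteEdges_adj, addEdge_adj]
    simp only [Set.mem_singleton_iff, Sym2.eq_iff]
    have h1 : ¬ G.Adj u v := fun h => hr h.reachable
    have h2 : ¬ G.Adj v u := fun h => hr h.symm.reachable
    grind
  have hXY : X.card ≤ Y.card := by
    refine Finset.card_le_card_of_injOn (fun z => ⟨addEdge z.1 z.2.1 z.2.2, z.2⟩) ?_ ?_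
    · rintro ⟨G, u, v⟩ hz
      simp only [X, Finset.mem_coe, Finset.mem_sigma, Finset.mem_filter,
        Finset.mem_univ, true_and] at hz
      obtain ⟨hG, hp⟩ := hz
      have hr := nr G u v hp
      have hd := hdel G u v hp
      have hk := kappa_addEdge hstable G u v hp
      have hG' := Finset.mem_filter.1 hG
      have huv : u ≠ v := by rintro rfl; exact hp rfl
      simp only [Y, Finset.mem_coe, Finset.mem_sigma]
      constructor
      · refine Finset.mem_filter.2 ⟨?_, by omega⟩
        have hp' := hp
        rw [Ne, part_eq] at hp'
        have hor : good C G u ∨ good C G v := by tauto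
        rcases hor with hg | hg
        · exact hAdd G hG'.1 u v (by rwa [Ne, SimpleGraph.ConnectedComponent.eq]) hg
        · have := hAdd G hG'.1 v u
            (by rw [Ne, SimpleGraph.ConnectedComponent.eq]; exact fun h => hr h.symm) hg
          have hsw : addEdge G u v = addEdge G v u := by
            unfold addEdge; rw [Sym2.eq_swap]
          rwa [hsw]
      · simp only [brs, Finset.mem_filter, Finset.mem_univ, true_and]
        rw [hd]
        refine ⟨?_, hr⟩
        rw [addEdge_adj]; grind
    · rintro ⟨G, u, v⟩ hz ⟨G', u', v'⟩ hz' heq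
      simp only [X, Finset.mem_coe, Finset.mem_sigma, Finset.mem_filter,
        Finset.mem_univ, true_and] at hz hz'
      simp only [Sigma.mk.injEq, heq_eq_eq, Prod.mk.injEq] at heq
      obtain ⟨h1, rfl, rfl⟩ := heq
      have e1 := hdel G u v hz.2
      have e2 := hdel G' u v hz'.2
      rw [h1, e2] at e1
      rw [e1]
  have hfin := hX.trans (hXY.trans hY)
  have hpos : 0 < 2 * (n - (k + 2) + 1) := by omega
  refine Nat.le_of_mul_le_mul_right ?_ hpos
  calc _ = A2.card * ((k + 1) * (2 * (n - (k + 2) + 1))) := by ring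
    _ ≤ _ := hfin

lemma poisson_tail (a : ℕ → ℝ) (ha : ∀ k, 0 ≤ a k) (hstep : ∀ k : ℕ, (k + 1 : ℝ) * a (k + 1) ≤ a k)
    (s M : ℕ) (hsM : s ≤ M) (N : ℝ) (hN : 0 < N) (hsum : ∑ k ∈ Finset.range M, a k ≤ N) :
    (∑ k ∈ Finset.Ico s M, a k) / N ≤
      ∑' j : ℕ, if s ≤ j then Real.exp (-1) / (Nat.factorial j) else 0 := by
  have hb : Antitone (fun k => a k * (Nat.factorial k : ℝ)) := by
    refine antitone_nat_of_succ_le fun k => ?_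
    rw [Nat.factorial_succ]
    push_cast
    have := mul_le_mul_of_nonneg_right (hstep k) (Nat.cast_nonneg (α := ℝ) (Nat.factorial k))
    linarith
  set b := a s * (Nat.factorial s : ℝ) with hbdef
  have hb0 : 0 ≤ b := mul_nonneg (ha s) (Nat.cast_nonneg _)
  have hf : ∀ k, (0 : ℝ) < Nat.factorial k := fun k => by exact_mod_cast Nat.factorial_pos k
  set T := ∑ k ∈ Finset.Ico s M, a k
  set H := ∑ k ∈ Finset.range s, a k
  have hTH : H + T ≤ N := by
    rw [Finset.sum_range_add_sum_Ico _ hsM]; exact hsum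
  set w : ℕ → ℝ := fun j => Real.exp (-1) / (Nat.factorial j) with hw
  have hw0 : ∀ j, 0 ≤ w j := fun j => div_nonneg (Real.exp_pos _).le (hf j).le
  have hws : HasSum w 1 := by
    have h1 : HasSum (fun j : ℕ => (1 : ℝ) ^ j / (Nat.factorial j)) (Real.exp 1) := by
      rw [Real.exp_eq_exp_ℝ]; exact NormedSpace.expSeries_div_hasSum_exp (1 : ℝ)
    have h2 := h1.mul_left (Real.exp (-1))
    rw [← Real.exp_add] at h2
    simpa [hw, div_eq_mul_inv] using h2
  have hsm : Summable (fun j => if s ≤ j then w j else 0) :=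
    Summable.of_nonneg_of_le (fun j => by split_ifs <;> simp [hw0]) (fun j => by
      split_ifs
      · exact le_rfl
      · exact hw0 j) hws.summable
  set E := ∑' j : ℕ, if s ≤ j then w j else 0 with hE
  set F := ∑ j ∈ Finset.range s, w j with hF
  have hEF : F + E = 1 := by
    have h1 : HasSum (fun j => if j < s then w j else 0) F := by
      have := hasSum_sum_of_ne_finset_zero (L := .unconditional ℕ) (f := fun j => if j < s then w j else 0)
        (s := Finset.range s) (fun j hj => by
          rw [Finset.mem_range] at hj; simp [hj])
      convert this using 1
      exact Finset.sum_congr rfl fun j hj => by simp [Finset.mem_range.1 hj]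
    have h2 := h1.add hsm.hasSum
    refine h2.unique ?_
    convert hws using 2 with j
    by_cases hj : j < s
    · simp [hj, not_le.2 hj]
    · simp [hj, not_lt.1 hj]
  have hex := Real.exp_pos (-1)
  have hT : Real.exp (-1) * T ≤ b * E := by
    have h1 : ∑ k ∈ Finset.Ico s M, w k ≤ E := by
      have := hsm.sum_le_tsum (Finset.Ico s M) (fun j _ => by split_ifs <;> simp [hw0])
      refine le_trans (le_of_eq ?_) this
      exact Finset.sum_congr rfl fun j hj => by simp [(Finset.mem_Ico.1 hj).1]
    refine le_trans ?_ (mul_le_mul_of_nonneg_left h1 hb0)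
    rw [Finset.mul_sum, Finset.mul_sum]
    refine Finset.sum_le_sum fun k hk => ?_
    have h2 : a k * (Nat.factorial k : ℝ) ≤ b := hb (Finset.mem_Ico.1 hk).1
    have h3 : a k ≤ b / Nat.factorial k := by rwa [le_div_iff₀ (hf k)]
    calc _ ≤ Real.exp (-1) * (b / Nat.factorial k) := mul_le_mul_of_nonneg_left h3 hex.le
      _ = _ := by simp only [hw]; ring
  have hH : b * F ≤ Real.exp (-1) * H := by
    rw [Finset.mul_sum, Finset.mul_sum]
    refine Finset.sum_le_sum fun k hk => ?_
    have h2 : b ≤ a k * (Nat.factorial k : ℝ) := hb (Finset.mem_range.1 hk).le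
    have h3 : b / Nat.factorial k ≤ a k := by rwa [div_le_iff₀ (hf k)]
    calc _ = Real.exp (-1) * (b / Nat.factorial k) := by simp only [hw]; ring
      _ ≤ _ := mul_le_mul_of_nonneg_left h3 hex.le
  have hE0 : 0 ≤ E := tsum_nonneg fun j => by split_ifs <;> simp [hw0]
  have hF0 : 0 ≤ F := Finset.sum_nonneg fun j _ => hw0 j
  rw [div_le_iff₀ hN]
  have h4 : T * F ≤ H * E := by
    have h5 := mul_le_mul_of_nonneg_right hT hF0
    have h6 := mul_le_mul_of_nonneg_right hH hE0
    have h7 : Real.exp (-1) * (T * F) ≤ Real.exp (-1) * (H * E) := by nlinarith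
    exact le_of_mul_le_mul_left h7 hex
  have h8 : T * (F + E) ≤ E * N := by nlinarith
  rwa [hEF, mul_one] at h8

end Aux6

/-- if `C` is a bridge-stable class of connected graphs, each bridge-addable in
`A`, then for `R_n` uniform on `A_n`, `κ⁺(R_n, C)` is stochastically dominated by
`1 + Po(1)`: for every `t`, `P(κ⁺(R_n,C) ≥ t) ≤ P(1 + Po(1) ≥ t)`. -/
theorem stmt6 (n : ℕ) (𝒜 : Finset (SimpleGraph (Fin n))) (hne : 𝒜.Nonempty)
    (C : ∀ m : ℕ, Set (SimpleGraph (Fin m)))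
    (hCconn : ∀ m, ∀ H ∈ C m, SimpleGraph.Connected H)
    (hstable : bridgeStable C)
    (hAdd : ∀ G ∈ 𝒜, ∀ u v : Fin n,
      G.connectedComponentMk u ≠ G.connectedComponentMk v →
      memClass C (compGraph G u) → addEdge G u v ∈ 𝒜) :
    ∀ t : ℕ,
      (Nat.card {G : SimpleGraph (Fin n) // G ∈ 𝒜 ∧ t ≤ kappaPlus C G} : ℝ) / 𝒜.card
        ≤ ∑' j : ℕ, if t ≤ 1 + j then Real.exp (-1) / (Nat.factorial j) else 0 := by
  intro t
  have hN : (0 : ℝ) < 𝒜.card := by exact_mod_cast hne.card_pos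
  let a : ℕ → ℝ := fun k => ((𝒜.filter (fun G => kappaPlus C G = k + 1)).card : ℝ)
  have hstep : ∀ k : ℕ, (k + 1 : ℝ) * a (k + 1) ≤ a k := fun k => by
    have := Aux6.step 𝒜 C hstable hAdd k
    simp only [a]
    exact_mod_cast this
  have ha : ∀ k, 0 ≤ a k := fun k => Nat.cast_nonneg _
  have hkn : ∀ G : SimpleGraph (Fin n), kappaPlus C G ≤ n := fun G => by
    rw [Aux6.kappa_eq]
    simpa using Finset.card_image_le (s := Finset.univ) (f := Aux6.part C G)
  have hfib : ∀ S : Finset ℕ, ∑ k ∈ S, a k =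
      ((𝒜.filter (fun G => ∃ k ∈ S, kappaPlus C G = k + 1)).card : ℝ) := by
    intro S
    simp only [a]
    rw [← Nat.cast_sum, ← Finset.card_biUnion]
    · congr 2
      ext G
      simp only [Finset.mem_biUnion, Finset.mem_filter]
      tauto
    · intro i _ j _ hij
      rw [Function.onFun, Finset.disjoint_left]
      intro G h1 h2
      simp only [Finset.mem_filter] at h1 h2
      omega
  have hle : ∀ S : Finset ℕ, ∑ k ∈ S, a k ≤ 𝒜.card := fun S => by
    rw [hfib]; exact_mod_cast Finset.card_filter_le _ _
  have hcard : Nat.card {G : SimpleGraph (Fin n) // G ∈ 𝒜 ∧ t ≤ kappaPlus C G} =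
      (𝒜.filter (fun G => t ≤ kappaPlus C G)).card := by
    rw [Nat.card_eq_fintype_card, Fintype.card_subtype]
    congr 1
    ext G; simp
  rw [hcard]
  rcases Nat.eq_zero_or_pos t with rfl | ht
  · have h1 : HasSum (fun j : ℕ => (1 : ℝ) ^ j / (Nat.factorial j)) (Real.exp 1) := by
      rw [Real.exp_eq_exp_ℝ]; exact NormedSpace.expSeries_div_hasSum_exp (1 : ℝ)
    have h2 := h1.mul_left (Real.exp (-1))
    rw [← Real.exp_add] at h2
    have h3 : HasSum (fun j : ℕ => if 0 ≤ 1 + j then Real.exp (-1) / (Nat.factorial j) else 0)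
        1 := by
      simpa [div_eq_mul_inv] using h2
    rw [h3.tsum_eq]
    simp [hN.ne']
  · obtain ⟨s, rfl⟩ : ∃ s, t = 1 + s := ⟨t - 1, by omega⟩
    have := Aux6.poisson_tail a ha hstep s (s + n) (by omega) 𝒜.card hN (hle _)
    rw [hfib] at this
    simp only [Nat.add_le_add_iff_left]
    convert this using 4
    ext G
    simp only [Finset.mem_filter, Finset.mem_Ico]
    have := hkn G
    constructor
    · rintro ⟨h1, h2⟩
      exact ⟨h1, kappaPlus C G - 1, by omega, by omega⟩
    · rintro ⟨h1, k, h2, h3⟩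
      exact ⟨h1, by omega⟩
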